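/- The finite simple graph H on vertex set {0,1,…,14} with edge set {{0,1},{0,2},{0,13},{1,2},{1,6},{2,3},{3,4},{3,7},{3,14},{4,5},{4,7},{5,6},{5,9},{6,9},{7,8},{7,10},{7,13},{8,9},{8,12},{10,11},{11,12},{10,13},{11,14},{12,14}} is not embeddable. -/

import Mathlib

open Matrix

/-- A 010-coloring of a graph: no two adjacent vertices are both 0,
and no triangle has all three vertices 1. -/
def Is010Coloring {V : Type*} (G : SimpleGraph V) (c : V → Fin 2) : Prop :=
  (∀ u v : V, G.Adj u v → ¬(c u = 0 ∧ c v = 0)) ∧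
  (∀ u v w : V, G.Adj u v → G.Adj v w → G.Adj u w →
    ¬(c u = 1 ∧ c v = 1 ∧ c w = 1))

/-- A graph is 010-colorable if it admits a 010-coloring. -/
def Is010Colorable {V : Type*} (G : SimpleGraph V) : Prop :=
  ∃ c : V → Fin 2, Is010Coloring G c

/-- An embedding of a graph into ℝ³: adjacent vertices map to orthogonal
vectors, and distinct vertices map to non-collinear vectors. -/
def IsEmbedding {V : Type*} (G : SimpleGraph V) (p : V → Fin 3 → ℝ) : Prop :=
  (∀ u v : V, G.Adj u v → p u ⬝ᵥ p v = 0) ∧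
  (∀ u v : V, u ≠ v → crossProduct (p u) (p v) ≠ 0)

/-- A graph is embeddable if it admits an embedding into ℝ³. -/
def Embeddable {V : Type*} (G : SimpleGraph V) : Prop :=
  ∃ p : V → Fin 3 → ℝ, IsEmbedding G p

/-- The edge list of the 15-vertex graph. -/
def ksEdges15 : List (Fin 15 × Fin 15) :=
  [(0,1),(0,2),(0,13),(1,2),(1,6),(2,3),(3,4),(3,7),(3,14),(4,5),(4,7),
   (5,6),(5,9),(6,9),(7,8),(7,10),(7,13),(8,9),(8,12),(10,11),(11,12),
   (10,13),(11,14),(12,14)]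

/-- The 15-vertex graph with the given edge set. -/
def ksGraph15 : SimpleGraph (Fin 15) :=
  SimpleGraph.fromRel (fun a b => (a, b) ∈ ksEdges15)

/-- The dot product in dimension three, in coordinates. -/
lemma vec3_dot (u v : Fin 3 → ℝ) : u ⬝ᵥ v = u 0 * v 0 + u 1 * v 1 + u 2 * v 2 := by
  simp [dotProduct, Fin.sum_univ_three]

/-- A vector orthogonal to `u` and `v` is a multiple of `u × v`. -/
lemma exists_smul_cross (u v w : Fin 3 → ℝ) (hc : crossProduct u v ≠ 0)
    (hu : u ⬝ᵥ w = 0) (hv : v ⬝ᵥ w = 0) : ∃ k : ℝ, w = k • crossProduct u v := by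
  have hcc : crossProduct u v ⬝ᵥ crossProduct u v ≠ 0 := by
    rwa [Ne, dotProduct_self_eq_zero]
  refine ⟨(w ⬝ᵥ crossProduct u v) / (crossProduct u v ⬝ᵥ crossProduct u v), ?_⟩
  simp only [cross_apply, vec3_dot, Matrix.cons_val_zero, Matrix.cons_val_one,
    Matrix.cons_val] at hcc hu hv ⊢
  ext i
  simp only [Pi.smul_apply, smul_eq_mul]
  rw [div_mul_eq_mul_div, eq_div_iff hcc]
  fin_cases i <;> simp <;> clear hcc hc <;> grind

/-- The final real-number contradiction. -/
lemma final_real (a b c s x z u v m n : ℝ) (ha : a ≠ 0) (hc : c ≠ 0) (hz : z ≠ 0)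
    (hv : v ≠ 0) (hn : n ≠ 0) (h1 : c * a * (m ^ 2 + n ^ 2) + s * b * n ^ 2 = 0)
    (h2 : -z ^ 2 * (a * s) * (u ^ 2 + v ^ 2) + v ^ 2 * (b * c) * (x ^ 2 + z ^ 2)
      + x * z * u * v * (a * c) = 0) : False := by
  have key : 4 * (a * c) ^ 2 * (m ^ 2 + n ^ 2) * v ^ 2 * z ^ 2 * (x ^ 2 + z ^ 2) * (u ^ 2 + v ^ 2)
      ≤ n ^ 2 * (x * z * u * v * (a * c)) ^ 2 := by
    have e : x * z * u * v * (a * c) =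
      z ^ 2 * (a * s) * (u ^ 2 + v ^ 2) - v ^ 2 * (b * c) * (x ^ 2 + z ^ 2) := by linarith
    rw [e]
    have h0 : 0 ≤ n ^ 2 * (z ^ 2 * (a * s) * (u ^ 2 + v ^ 2)
        + v ^ 2 * (b * c) * (x ^ 2 + z ^ 2)) ^ 2 := by positivity
    have h3 : 4 * (a * c) * v ^ 2 * z ^ 2 * (x ^ 2 + z ^ 2) * (u ^ 2 + v ^ 2) *
      (c * a * (m ^ 2 + n ^ 2) + s * b * n ^ 2) = 0 := by rw [h1, mul_zero]
    linarith
  have hpos : 0 < (a * c) ^ 2 * n ^ 2 * v ^ 2 * z ^ 2 * (z ^ 2 * v ^ 2) := by positivity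
  have hrest : 0 ≤ (a * c) ^ 2 * v ^ 2 * z ^ 2 *
    (4 * m ^ 2 * (x ^ 2 + z ^ 2) * (u ^ 2 + v ^ 2) + 3 * n ^ 2 * (x ^ 2 + z ^ 2) * (u ^ 2 + v ^ 2)
      + n ^ 2 * (x ^ 2 * v ^ 2 + z ^ 2 * u ^ 2)) := by positivity
  linarith

/-- The graph has no embedding where 3, 4, 7 lie on the coordinate axes. -/
lemma no_axis_embedding (q : Fin 15 → Fin 3 → ℝ) (hq : IsEmbedding ksGraph15 q)
    (h31 : q 3 1 = 0) (h32 : q 3 2 = 0) (h40 : q 4 0 = 0) (h42 : q 4 2 = 0)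
    (h70 : q 7 0 = 0) (h71 : q 7 1 = 0) : False := by
  obtain ⟨ho, hx⟩ := hq
  have hne : ∀ i : Fin 15, q i ≠ 0 := by
    intro i hi
    rcases eq_or_ne i 0 with rfl | h
    · exact hx 0 1 (by decide) (by rw [hi]; simp)
    · exact hx i 0 h (by rw [hi]; simp)
  have h30 : q 3 0 ≠ 0 := fun h => hne 3 (by ext i; fin_cases i <;> simp [h, h31, h32])
  have h41 : q 4 1 ≠ 0 := fun h => hne 4 (by ext i; fin_cases i <;> simp [h, h40, h42])
  have h72 : q 7 2 ≠ 0 := fun h => hne 7 (by ext i; fin_cases i <;> simp [h, h70, h71])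
  have adj : ∀ a b : Fin 15, (a, b) ∈ ksEdges15 → q a ⬝ᵥ q b = 0 := by
    intro a b hab
    apply ho
    rw [ksGraph15, SimpleGraph.fromRel_adj]
    refine ⟨?_, Or.inl hab⟩
    rintro rfl
    revert a
    decide
  have adj' : ∀ a b : Fin 15, (a, b) ∈ ksEdges15 → q b ⬝ᵥ q a = 0 := by
    intro a b hab
    rw [dotProduct_comm]; exact adj a b hab
  have z3 : ∀ i, q 3 ⬝ᵥ q i = 0 → q i 0 = 0 := by
    intro i h
    simpa [vec3_dot, h31, h32, h30] using h
  have z4 : ∀ i, q 4 ⬝ᵥ q i = 0 → q i 1 = 0 := by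
    intro i h
    simpa [vec3_dot, h40, h42, h41] using h
  have z7 : ∀ i, q 7 ⬝ᵥ q i = 0 → q i 2 = 0 := by
    intro i h
    simpa [vec3_dot, h70, h71, h72] using h
  have c20 := z3 2 (adj' 2 3 (by decide))
  have c140 := z3 14 (adj 3 14 (by decide))
  have c51 := z4 5 (adj 4 5 (by decide))
  have c82 := z7 8 (adj 7 8 (by decide))
  have c102 := z7 10 (adj 7 10 (by decide))
  have ha : q 8 0 ≠ 0 := fun h => hx 8 4 (by decide) (by simp [cross_apply, h, c82, h40, h42])
  have hc : q 10 0 ≠ 0 := fun h => hx 10 4 (by decide) (by simp [cross_apply, h, c102, h40, h42])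
  have hz : q 5 2 ≠ 0 := fun h => hx 5 3 (by decide) (by simp [cross_apply, h, c51, h31, h32])
  have hv : q 2 2 ≠ 0 := fun h => hx 2 4 (by decide) (by simp [cross_apply, h, c20, h40, h42])
  have hn : q 14 2 ≠ 0 := fun h => hx 14 4 (by decide) (by simp [cross_apply, h, c140, h40, h42])
  have ex : ∀ a b c : Fin 15, a ≠ b → q a ⬝ᵥ q c = 0 → q b ⬝ᵥ q c = 0 →
      ∃ k : ℝ, k ≠ 0 ∧ q c = k • crossProduct (q a) (q b) := by
    intro a b c hab h1 h2
    obtain ⟨k, hk⟩ := exists_smul_cross _ _ _ (hx a b hab) h1 h2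
    refine ⟨k, ?_, hk⟩
    rintro rfl
    exact hne c (by rw [hk, zero_smul])
  obtain ⟨k11, n11, e11⟩ := ex 10 14 11 (by decide) (adj _ _ (by decide)) (adj' _ _ (by decide))
  obtain ⟨k12, n12, e12⟩ := ex 8 14 12 (by decide) (adj _ _ (by decide)) (adj' _ _ (by decide))
  obtain ⟨k9, n9, e9⟩ := ex 5 8 9 (by decide) (adj _ _ (by decide)) (adj _ _ (by decide))
  obtain ⟨k6, n6, e6⟩ := ex 5 9 6 (by decide) (adj _ _ (by decide)) (adj' _ _ (by decide))
  obtain ⟨k13, n13, e13⟩ := ex 7 10 13 (by decide) (adj _ _ (by decide)) (adj _ _ (by decide))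
  obtain ⟨k0, n0, e0⟩ := ex 2 13 0 (by decide) (adj' _ _ (by decide)) (adj' _ _ (by decide))
  obtain ⟨k1, n1, e1⟩ := ex 2 0 1 (by decide) (adj' _ _ (by decide)) (adj _ _ (by decide))
  have o1 := adj 11 12 (by decide)
  have o2 := adj 1 6 (by decide)
  rw [e11, e12] at o1
  rw [e1, e6, e0, e9, e13] at o2
  simp only [smul_dotProduct, dotProduct_smul, map_smul, smul_eq_mul,
    mul_eq_zero, n11, n12, n0, n1, n6, n9, n13, false_or] at o1 o2
  simp only [cross_apply, vec3_dot, Matrix.cons_val_zero, Matrix.cons_val_one,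
    Matrix.cons_val, c20, c140, c51, c82, c102, h70, h71] at o1 o2
  refine final_real (q 8 0) (q 8 1) (q 10 0) (q 10 1) (q 5 0) (q 5 2) (q 2 1) (q 2 2)
    (q 14 1) (q 14 2) ha hc hz hv hn (by linarith) ?_
  refine (mul_eq_zero.mp (?_ : q 7 2 * _ = 0)).resolve_left h72
  linarith

/-- The 15-vertex graph `ksGraph15` is not embeddable. -/
theorem ksGraph15_not_embeddable : ¬ Embeddable ksGraph15 := by
  rintro ⟨p, ho, hx⟩
  have o34 : p 3 ⬝ᵥ p 4 = 0 := ho _ _ (by simp [ksGraph15, ksEdges15])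
  have o37 : p 3 ⬝ᵥ p 7 = 0 := ho _ _ (by simp [ksGraph15, ksEdges15])
  have o47 : p 4 ⬝ᵥ p 7 = 0 := ho _ _ (by simp [ksGraph15, ksEdges15])
  have o43 : p 4 ⬝ᵥ p 3 = 0 := by rw [dotProduct_comm, o34]
  have o73 : p 7 ⬝ᵥ p 3 = 0 := by rw [dotProduct_comm, o37]
  have o74 : p 7 ⬝ᵥ p 4 = 0 := by rw [dotProduct_comm, o47]
  have nrm : ∀ i : Fin 15, i ≠ 0 → ∃ r : ℝ, r * (r * (p i ⬝ᵥ p i)) = 1 := by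
    intro i h
    have h0 : p i ⬝ᵥ p i ≠ 0 := by
      rw [Ne, dotProduct_self_eq_zero]
      intro hi
      exact hx i 0 h (by rw [hi]; simp)
    have h1 : 0 ≤ p i ⬝ᵥ p i := by
      rw [vec3_dot]
      nlinarith [mul_self_nonneg (p i 0), mul_self_nonneg (p i 1), mul_self_nonneg (p i 2)]
    refine ⟨(Real.sqrt (p i ⬝ᵥ p i))⁻¹, ?_⟩
    rw [← mul_assoc, ← mul_inv, Real.mul_self_sqrt h1, inv_mul_cancel₀ h0]
  obtain ⟨r3, hr3⟩ := nrm 3 (by decide)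
  obtain ⟨r4, hr4⟩ := nrm 4 (by decide)
  obtain ⟨r7, hr7⟩ := nrm 7 (by decide)
  let M : Matrix (Fin 3) (Fin 3) ℝ := Matrix.of ![r3 • p 3, r4 • p 4, r7 • p 7]
  have hM : M * Mᵀ = 1 := by
    ext i j
    change ![r3 • p 3, r4 • p 4, r7 • p 7] i ⬝ᵥ ![r3 • p 3, r4 • p 4, r7 • p 7] j = _
    fin_cases i <;> fin_cases j <;>
      simp [o34, o37, o47, o43, o73, o74, hr3, hr4, hr7]
  have hM' : Mᵀ * M = 1 := mul_eq_one_comm.mp hM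
  have hinj : Function.Injective M.mulVecLin := by
    intro u v huv
    have := congrArg (Mᵀ *ᵥ ·) huv
    simpa [Matrix.mulVec_mulVec, hM'] using this
  refine no_axis_embedding (fun i => M *ᵥ p i) ⟨?_, ?_⟩ ?_ ?_ ?_ ?_ ?_ ?_
  · intro u v huv
    change (M *ᵥ p u) ⬝ᵥ (M *ᵥ p v) = 0
    rw [Matrix.dotProduct_mulVec, ← Matrix.mulVec_transpose, Matrix.mulVec_mulVec, hM',
      Matrix.one_mulVec]
    exact ho u v huv
  · intro u v huv
    have h := hx u v huv
    rw [crossProduct_ne_zero_iff_linearIndependent] at h ⊢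
    have h2 := h.map' M.mulVecLin (LinearMap.ker_eq_bot.mpr hinj)
    have e : M.mulVecLin ∘ ![p u, p v] = ![M *ᵥ p u, M *ᵥ p v] := by
      ext i j
      fin_cases i <;> simp
    rw [e] at h2
    exact h2
  · change (r4 • p 4) ⬝ᵥ p 3 = 0
    simp [o43]
  · change (r7 • p 7) ⬝ᵥ p 3 = 0
    simp [o73]
  · change (r3 • p 3) ⬝ᵥ p 4 = 0
    simp [o34]
  · change (r7 • p 7) ⬝ᵥ p 4 = 0
    simp [o74]
  · change (r3 • p 3) ⬝ᵥ p 7 = 0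
    simp [o37]
  · change (r4 • p 4) ⬝ᵥ p 7 = 0
    simp [o47]
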